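/- Fix x₂, x₂* with x₂ + x₂* > 0 and arbitrary real x₁, x₁*. For all α > 0 and c > 0, the function ξ ↦ ( μ(ξ) − c·α·μ(ξ/α) )·e^{i μ(ξ)(x₂ + x₂*) + i ξ (x₁* − x₁)} / ( μ(ξ)·( μ(ξ) + c·α·μ(ξ/α) ) ) is Lebesgue integrable on ℝ: near ξ = ±k₀ the singularity is of order |k₀² − ξ²|^{−1/2} and hence integrable, while for |ξ| > k₀ the factor e^{i μ(ξ)(x₂ + x₂*)} = e^{−√(ξ² − k₀²)(x₂ + x₂*)} decays exponentially. In particular, the reflected part of the upper-half-plane background Green's function exists as a Lebesgue integral. -/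

import Mathlib

open MeasureTheory

/-- The function `μ(ξ) = √(k₀² − ξ²)` for `|ξ| ≤ k₀` and `μ(ξ) = i·√(ξ² − k₀²)` for
`|ξ| > k₀` (the principal square root of `k₀² − ξ²`). -/
noncomputable def mu (k₀ ξ : ℝ) : ℂ :=
  if |ξ| ≤ k₀ then ((Real.sqrt (k₀ ^ 2 - ξ ^ 2) : ℝ) : ℂ)
  else Complex.I * ((Real.sqrt (ξ ^ 2 - k₀ ^ 2) : ℝ) : ℂ)

theorem norm_mu {k₀ : ℝ} (hk₀ : 0 ≤ k₀) (ξ : ℝ) : ‖mu k₀ ξ‖ = √|ξ ^ 2 - k₀ ^ 2| := by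
  unfold mu
  split_ifs with hξ
  · have hk : ξ ^ 2 ≤ k₀ ^ 2 := sq_le_sq' (abs_le.mp hξ).1 (abs_le.mp hξ).2
    rw [Complex.norm_real, Real.norm_of_nonneg (Real.sqrt_nonneg _), abs_sub_comm,
      abs_of_nonneg (sub_nonneg.mpr hk)]
  · rw [norm_mul, Complex.norm_I, one_mul, Complex.norm_real,
      Real.norm_of_nonneg (Real.sqrt_nonneg _)]
    rcases le_total (k₀ ^ 2) (ξ ^ 2) with h | h
    · rw [abs_of_nonneg (sub_nonneg.mpr h)]
    · exact absurd (abs_le.mpr (abs_le_of_sq_le_sq' h hk₀)) hξ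

theorem mu_re_nonneg (k₀ ξ : ℝ) : 0 ≤ (mu k₀ ξ).re := by
  unfold mu
  split_ifs <;> simp

theorem mu_im_nonneg (k₀ ξ : ℝ) : 0 ≤ (mu k₀ ξ).im := by
  unfold mu
  split_ifs <;> simp

theorem measurable_mu (k₀ : ℝ) : Measurable (mu k₀) := by
  unfold mu
  exact Measurable.ite (measurableSet_le (by fun_prop) (by fun_prop)) (by fun_prop) (by fun_prop)

theorem abs_sub_le_mu_im (k₀ ξ : ℝ) (hk₀ : 0 < k₀) :
    |(|ξ| - k₀)| - k₀ ≤ (mu k₀ ξ).im := by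
  unfold mu
  split_ifs with hξ
  · rw [Complex.ofReal_im, abs_of_nonpos (by linarith)]
    linarith [abs_nonneg ξ]
  · rw [not_le] at hξ
    have him : (Complex.I * ((√(ξ ^ 2 - k₀ ^ 2) : ℝ) : ℂ)).im = √(ξ ^ 2 - k₀ ^ 2) := by simp
    rw [him, abs_of_pos (by linarith)]
    have hsqrt : |ξ| - k₀ ≤ √(ξ ^ 2 - k₀ ^ 2) := by
      apply Real.le_sqrt_of_sq_le
      rw [← sq_abs ξ]
      nlinarith
    linarith

/-- Two numbers in the closed first quadrant satisfy `|z - w| ≤ |z + w|`. -/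
theorem norm_sub_le_norm_add_of_quadrant {z w : ℂ} (hzr : 0 ≤ z.re) (hzi : 0 ≤ z.im)
    (hwr : 0 ≤ w.re) (hwi : 0 ≤ w.im) : ‖z - w‖ ≤ ‖z + w‖ := by
  rw [← sq_le_sq₀ (norm_nonneg _) (norm_nonneg _), Complex.sq_norm, Complex.sq_norm,
    Complex.normSq_apply, Complex.normSq_apply]
  simp only [Complex.sub_re, Complex.sub_im, Complex.add_re, Complex.add_im]
  nlinarith [mul_nonneg hzr hwr, mul_nonneg hzi hwi]

theorem integrable_inv_sqrt_abs_mul_exp {h : ℝ} (hh : 0 < h) :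
    Integrable (fun t : ℝ => (√|t|)⁻¹ * Real.exp (-(h * |t|))) := by
  have hpos : IntegrableOn (fun t : ℝ => (√|t|)⁻¹ * Real.exp (-(h * |t|))) (Set.Ioi 0) := by
    refine (integrableOn_rpow_mul_exp_neg_mul_rpow (s := -(1 / 2)) (p := 1) (by norm_num)
      one_pos hh).congr_fun (fun t ht => ?_) measurableSet_Ioi
    have ht' : 0 < t := ht
    simp only [Real.rpow_one, abs_of_pos ht', Real.sqrt_eq_rpow, Real.rpow_neg ht'.le, neg_mul]
  have hneg : IntegrableOn (fun t : ℝ => (√|t|)⁻¹ * Real.exp (-(h * |t|))) (Set.Iic 0) := by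
    rw [integrableOn_Iic_iff_integrableOn_Iio]
    rw [← neg_zero] at hpos
    simpa only [abs_neg] using hpos.comp_neg_Iio
  rw [← integrableOn_univ, ← Set.Iic_union_Ioi (a := (0 : ℝ))]
  exact hneg.union hpos

theorem exp_neg_mu_im_div_norm_mu_le {k₀ h : ℝ} (hk₀ : 0 < k₀) (hh : 0 < h) (ξ : ℝ) :
    Real.exp (-(h * (mu k₀ ξ).im)) / ‖mu k₀ ξ‖ ≤
      Real.exp (h * k₀) * (√k₀)⁻¹ *
        ((√|(|ξ| - k₀)|)⁻¹ * Real.exp (-(h * |(|ξ| - k₀)|))) := by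
  have hexp : Real.exp (-(h * (mu k₀ ξ).im)) ≤
      Real.exp (h * k₀) * Real.exp (-(h * |(|ξ| - k₀)|)) := by
    rw [← Real.exp_add, Real.exp_le_exp]
    nlinarith [mul_le_mul_of_nonneg_left (abs_sub_le_mu_im k₀ ξ hk₀) hh.le]
  have hnorm : ‖mu k₀ ξ‖⁻¹ ≤ (√k₀)⁻¹ * (√|(|ξ| - k₀)|)⁻¹ := by
    have hfac : |ξ ^ 2 - k₀ ^ 2| = (|ξ| + k₀) * |(|ξ| - k₀)| := by
      rw [← sq_abs ξ, sq_sub_sq, abs_mul, abs_of_pos (by positivity : 0 < |ξ| + k₀)]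
    rw [norm_mu hk₀.le, hfac, Real.sqrt_mul (by positivity), mul_inv]
    gcongr
    linarith [abs_nonneg ξ]
  rw [div_eq_mul_inv]
  calc _ ≤ (Real.exp (h * k₀) * Real.exp (-(h * |(|ξ| - k₀)|))) *
        ((√k₀)⁻¹ * (√|(|ξ| - k₀)|)⁻¹) := by gcongr
    _ = _ := by ring

theorem integrable_exp_neg_mu_im_div_norm_mu {k₀ h : ℝ} (hk₀ : 0 < k₀) (hh : 0 < h) :
    Integrable (fun ξ : ℝ => Real.exp (-(h * (mu k₀ ξ).im)) / ‖mu k₀ ξ‖) := by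
  have hψ := integrable_inv_sqrt_abs_mul_exp hh
  refine (((hψ.comp_sub_right k₀).add (hψ.comp_add_right k₀)).const_mul
    (Real.exp (h * k₀) * (√k₀)⁻¹)).mono' ?_ (Filter.Eventually.of_forall fun ξ => ?_)
  · have := measurable_mu k₀
    have := Complex.measurable_im.comp this
    exact Measurable.aestronglyMeasurable (by fun_prop)
  · rw [Real.norm_of_nonneg (by positivity)]
    refine (exp_neg_mu_im_div_norm_mu_le hk₀ hh ξ).trans ?_
    gcongr
    simp only [Pi.add_apply]
    rcases abs_cases ξ with ⟨hξ, -⟩ | ⟨hξ, -⟩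
    · rw [hξ]
      exact le_add_of_nonneg_right (by positivity)
    · rw [hξ, show -ξ - k₀ = -(ξ + k₀) by ring, abs_neg]
      exact le_add_of_nonneg_left (by positivity)

/-- for `x₂ + x₂* > 0` and any `α, c > 0`, the integrand of the reflected
part of the upper-half-plane background Green's function,
`ξ ↦ (μ(ξ) − cα μ(ξ/α)) e^{i μ(ξ)(x₂ + x₂*) + i ξ(x₁* − x₁)} / (μ(ξ)(μ(ξ) + cα μ(ξ/α)))`,
is Lebesgue integrable on `ℝ` (the singularity at `ξ = ±k₀` is of order
`|k₀² − ξ²|^{-1/2}` and the exponential factor decays for `|ξ| > k₀`). -/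
theorem stmt19 (k₀ x₁ x₂ xs1 xs2 : ℝ)
    (hk₀ : 0 < k₀) (hx : 0 < x₂ + xs2) :
    ∀ α c : ℝ, 0 < α → 0 < c →
      Integrable (fun ξ : ℝ =>
        (mu k₀ ξ - (c : ℂ) * (α : ℂ) * mu k₀ (ξ / α)) *
          Complex.exp (Complex.I * mu k₀ ξ * ((x₂ + xs2 : ℝ) : ℂ)
              + Complex.I * ((ξ * (xs1 - x₁) : ℝ) : ℂ)) /
          (mu k₀ ξ * (mu k₀ ξ + (c : ℂ) * (α : ℂ) * mu k₀ (ξ / α)))) := by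
  intro α c hα hc
  have hmu := measurable_mu k₀
  refine (integrable_exp_neg_mu_im_div_norm_mu hk₀ hx).mono' ?_
    (Filter.Eventually.of_forall fun ξ => ?_)
  · exact Measurable.aestronglyMeasurable (by fun_prop)
  · have hexp : ‖Complex.exp (Complex.I * mu k₀ ξ * ((x₂ + xs2 : ℝ) : ℂ)
        + Complex.I * ((ξ * (xs1 - x₁) : ℝ) : ℂ))‖ =
        Real.exp (-((x₂ + xs2) * (mu k₀ ξ).im)) := by
      rw [Complex.norm_exp, Complex.add_re, Complex.re_mul_ofReal, Complex.I_mul_re,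
        Complex.I_mul_re, Complex.ofReal_im]
      ring_nf
    have hle : ‖mu k₀ ξ - (c : ℂ) * (α : ℂ) * mu k₀ (ξ / α)‖ ≤
        ‖mu k₀ ξ + (c : ℂ) * (α : ℂ) * mu k₀ (ξ / α)‖ := by
      rw [← Complex.ofReal_mul]
      apply norm_sub_le_norm_add_of_quadrant (mu_re_nonneg _ _) (mu_im_nonneg _ _)
      · rw [Complex.re_ofReal_mul]
        exact mul_nonneg (by positivity) (mu_re_nonneg _ _)
      · rw [Complex.im_ofReal_mul]
        exact mul_nonneg (by positivity) (mu_im_nonneg _ _)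
    rw [norm_div, norm_mul, norm_mul, hexp, mul_comm ‖mu k₀ ξ‖, mul_div_mul_comm]
    exact mul_le_of_le_one_left (by positivity) (div_le_one_of_le₀ hle (norm_nonneg _))
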